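/- arXiv:1912.05214 — 6 statements merged into one kernel-verified Lean document; each statement's English description precedes it below -/
import Mathlib

section
/- Sklar's theorem for quasi-distributions: Let F be a bivariate quasi-distribution with margins F_X and F_Y. Then there exists a quasi-copula C such that F(x,y) = C(F_X(x), F_Y(y)) for all (x,y) ∈ R̄². -/
open scoped Classical

noncomputable section

/-- The `F`-volume of the rectangle `[a₁,a₂] × [b₁,b₂]`. -/
def vol (F : EReal × EReal → ℝ) (a₁ a₂ b₁ b₂ : EReal) : ℝ :=
  F (a₂, b₂) - F (a₁, b₂) - F (a₂, b₁) + F (a₁, b₁)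

/-- `x ∈ R̄` is an infinite value, i.e. `−∞` or `+∞`. -/
def IsInfinite (x : EReal) : Prop := x = ⊥ ∨ x = ⊤

/-- A bivariate quasi-distribution on `R̄²`. -/
def IsQuasiDist (F : EReal × EReal → ℝ) : Prop :=
  (∀ p : EReal × EReal, F p ∈ Set.Icc (0:ℝ) 1) ∧
  (∀ x : EReal, F (x, ⊥) = 0) ∧ (∀ y : EReal, F (⊥, y) = 0) ∧
  F (⊤, ⊤) = 1 ∧
  (∀ a₁ a₂ b₁ b₂ : EReal, a₁ ≤ a₂ → b₁ ≤ b₂ →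
    (IsInfinite a₁ ∨ IsInfinite a₂ ∨ IsInfinite b₁ ∨ IsInfinite b₂) →
    0 ≤ vol F a₁ a₂ b₁ b₂)

/-- A bivariate distribution on `R̄²` (no right-continuity assumed). -/
def IsDist (F : EReal × EReal → ℝ) : Prop :=
  (∀ p : EReal × EReal, F p ∈ Set.Icc (0:ℝ) 1) ∧
  (∀ x : EReal, F (x, ⊥) = 0) ∧ (∀ y : EReal, F (⊥, y) = 0) ∧
  F (⊤, ⊤) = 1 ∧
  (∀ a₁ a₂ b₁ b₂ : EReal, a₁ ≤ a₂ → b₁ ≤ b₂ → 0 ≤ vol F a₁ a₂ b₁ b₂)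

/-- `F` has margins `FX` and `FY`. -/
def HasMargins (F : EReal × EReal → ℝ) (FX FY : EReal → ℝ) : Prop :=
  (∀ x, F (x, ⊤) = FX x) ∧ (∀ y, F (⊤, y) = FY y)

/-- A univariate distribution function on `R̄` (no right-continuity assumed). -/
def UnivDist (F : EReal → ℝ) : Prop :=
  Monotone F ∧ F ⊥ = 0 ∧ F ⊤ = 1

/-- A (nondegenerate) rectangle in `R̄²` with distinct standard corners. -/
structure Rect where
  x1 : EReal
  y1 : EReal
  x2 : EReal
  y2 : EReal
  hx : x1 < x2
  hy : y1 < y2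

/-- The multiplicity of a point with respect to a rectangle: `+1` at the main
corners (southwest and northeast), `−1` at the opposite corners. -/
def Rect.mult (R : Rect) (p : EReal × EReal) : ℤ :=
  (if p = (R.x1, R.y1) then 1 else 0) + (if p = (R.x2, R.y2) then 1 else 0)
    - (if p = (R.x2, R.y1) then 1 else 0) - (if p = (R.x1, R.y2) then 1 else 0)

/-- The interior of a rectangle, as a subset of `R̄²`. -/
def Rect.inter (R : Rect) : Set (EReal × EReal) :=
  Set.Ioo R.x1 R.x2 ×ˢ Set.Ioo R.y1 R.y2

/-- The image of a rectangle under the reflection `δ(x,y) = (−x,y)`. -/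
def Rect.reflect (R : Rect) : Rect where
  x1 := -R.x2
  y1 := R.y1
  x2 := -R.x1
  y2 := R.y2
  hx := EReal.neg_lt_neg_iff.mpr R.hx
  hy := R.hy

/-- A finite (formal) union of rectangles is represented by a list; membership in `ℜ`
additionally requires pairwise disjointness, see `disjU`. -/
def disjU (U : List Rect) : Prop :=
  U.Pairwise fun R S => Disjoint R.inter S.inter

/-- The multiplicity of a point with respect to a finite union of rectangles. -/
def multU (U : List Rect) (p : EReal × EReal) : ℤ :=
  (U.map fun R => R.mult p).sum

/-- The corners of a rectangle, as a list. -/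
def Rect.cornerList (R : Rect) : List (EReal × EReal) :=
  [(R.x1, R.y1), (R.x2, R.y2), (R.x2, R.y1), (R.x1, R.y2)]

/-- The set of corners of a finite union of rectangles. -/
def cornersU (U : List Rect) : Finset (EReal × EReal) :=
  (U.flatMap Rect.cornerList).toFinset

/-- `L^{(A,B)}(R) = Σ_{m_R(y)>0} B(y)·m_R(y) + Σ_{m_R(y)<0} A(y)·m_R(y)`. -/
def Lval (A B : EReal × EReal → ℝ) (U : List Rect) : ℝ :=
  ∑ p ∈ cornersU U,
    (if 0 < multU U p then B p * (multU U p : ℝ)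
     else if multU U p < 0 then A p * (multU U p : ℝ) else 0)

/-- Condition (Q1): `A ≤ B` pointwise. -/
def CondQ1 (A B : EReal × EReal → ℝ) : Prop := ∀ p, A p ≤ B p

/-- Condition (Q2): `L^{(A,B)}(R) ≥ 0` for all `R ∈ ℜ`. -/
def CondQ2 (A B : EReal × EReal → ℝ) : Prop :=
  ∀ U : List Rect, disjU U → 0 ≤ Lval A B U

/-- `P_O^{(A,B)}(x) = inf { L^{(A,B)}(R)/(−m_R(x)) : R ∈ ℜ, m_R(x) < 0 }`,
with the infimum of the empty set being `+∞`. -/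
def PO (A B : EReal × EReal → ℝ) (x : EReal × EReal) : EReal :=
  ⨅ U : {U : List Rect // disjU U ∧ multU U x < 0},
    ((Lval A B U.1 / (-(multU U.1 x) : ℝ) : ℝ) : EReal)

/-- `P_M^{(A,B)}(x) = inf { L^{(A,B)}(R)/m_R(x) : R ∈ ℜ, m_R(x) > 0 }`,
with the infimum of the empty set being `+∞`. -/
def PM (A B : EReal × EReal → ℝ) (x : EReal × EReal) : EReal :=
  ⨅ U : {U : List Rect // disjU U ∧ 0 < multU U x},
    ((Lval A B U.1 / ((multU U.1 x) : ℝ) : ℝ) : EReal)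

/-- `γ^{(A,B)}(x) = min { P_O^{(A,B)}(x), B(x) − A(x) }`. -/
def gammaAB (A B : EReal × EReal → ℝ) (x : EReal × EReal) : EReal :=
  min (PO A B x) ((B x - A x : ℝ) : EReal)

/-- A quasi-copula on `[0,1]²`. -/
def IsQuasiCopula (Q : ℝ → ℝ → ℝ) : Prop :=
  (∀ u ∈ Set.Icc (0:ℝ) 1, ∀ v ∈ Set.Icc (0:ℝ) 1, Q u v ∈ Set.Icc (0:ℝ) 1) ∧
  (∀ u ∈ Set.Icc (0:ℝ) 1, Q u 0 = 0 ∧ Q 0 u = 0 ∧ Q u 1 = u ∧ Q 1 u = u) ∧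
  (∀ u ∈ Set.Icc (0:ℝ) 1, ∀ u' ∈ Set.Icc (0:ℝ) 1, ∀ v ∈ Set.Icc (0:ℝ) 1,
    u ≤ u' → Q u v ≤ Q u' v ∧ Q v u ≤ Q v u') ∧
  (∀ u ∈ Set.Icc (0:ℝ) 1, ∀ u' ∈ Set.Icc (0:ℝ) 1, ∀ v ∈ Set.Icc (0:ℝ) 1,
    ∀ v' ∈ Set.Icc (0:ℝ) 1, |Q u v - Q u' v'| ≤ |u - u'| + |v - v'|)

/-- A copula on `[0,1]²`. -/
def IsCopula (C : ℝ → ℝ → ℝ) : Prop :=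
  (∀ u ∈ Set.Icc (0:ℝ) 1, ∀ v ∈ Set.Icc (0:ℝ) 1, C u v ∈ Set.Icc (0:ℝ) 1) ∧
  (∀ u ∈ Set.Icc (0:ℝ) 1, C u 0 = 0 ∧ C 0 u = 0 ∧ C u 1 = u ∧ C 1 u = u) ∧
  (∀ u₁ ∈ Set.Icc (0:ℝ) 1, ∀ u₂ ∈ Set.Icc (0:ℝ) 1, ∀ v₁ ∈ Set.Icc (0:ℝ) 1,
    ∀ v₂ ∈ Set.Icc (0:ℝ) 1, u₁ ≤ u₂ → v₁ ≤ v₂ →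
    0 ≤ C u₂ v₂ - C u₁ v₂ - C u₂ v₁ + C u₁ v₁)

/-- `𝒞(P,Q)`: the set of copulas lying pointwise between `P` and `Q` on `[0,1]²`. -/
def Cset (P Q : ℝ → ℝ → ℝ) : Set (ℝ → ℝ → ℝ) :=
  {C | IsCopula C ∧ ∀ u ∈ Set.Icc (0:ℝ) 1, ∀ v ∈ Set.Icc (0:ℝ) 1,
    P u v ≤ C u v ∧ C u v ≤ Q u v}

/-- `(P,Q)` is a coherent imprecise copula. -/
def CoherentImprecise (P Q : ℝ → ℝ → ℝ) : Prop :=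
  IsQuasiCopula P ∧ IsQuasiCopula Q ∧
  (∀ u ∈ Set.Icc (0:ℝ) 1, ∀ v ∈ Set.Icc (0:ℝ) 1, P u v ≤ Q u v) ∧
  (Cset P Q).Nonempty ∧
  (∀ u ∈ Set.Icc (0:ℝ) 1, ∀ v ∈ Set.Icc (0:ℝ) 1,
    P u v = sInf ((fun C => C u v) '' Cset P Q) ∧
    Q u v = sSup ((fun C => C u v) '' Cset P Q))

/-- `𝔇(A,B)`: the set of bivariate distributions with margins `FX`, `FY`
lying pointwise between `A` and `B`. -/
def Dset (FX FY : EReal → ℝ) (A B : EReal × EReal → ℝ) : Set (EReal × EReal → ℝ) :=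
  {F | IsDist F ∧ HasMargins F FX FY ∧ ∀ p, A p ≤ F p ∧ F p ≤ B p}

/-- The pointwise infimum of a set of bivariate functions. -/
def pinf (S : Set (EReal × EReal → ℝ)) : EReal × EReal → ℝ :=
  fun p => sInf ((fun F => F p) '' S)

/-- The pointwise supremum of a set of bivariate functions. -/
def psup (S : Set (EReal × EReal → ℝ)) : EReal × EReal → ℝ :=
  fun p => sSup ((fun F => F p) '' S)

/-- `S` is a coherent restricted bivariate `p`-box with margins `FX`, `FY`. -/
def CoherentPBox (FX FY : EReal → ℝ) (S : Set (EReal × EReal → ℝ)) : Prop :=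
  S.Nonempty ∧ (∀ F ∈ S, IsDist F ∧ HasMargins F FX FY) ∧
  S = Dset FX FY (pinf S) (psup S) ∧
  (∀ p, pinf S p = pinf (Dset FX FY (pinf S) (psup S)) p) ∧
  (∀ p, psup S p = psup (Dset FX FY (pinf S) (psup S)) p)

/-- A mesh `Δ = δ_x × δ_y`. -/
structure Mesh where
  sx : Finset EReal
  sy : Finset EReal
  botx : ⊥ ∈ sx
  topx : ⊤ ∈ sx
  boty : ⊥ ∈ sy
  topy : ⊤ ∈ sy
  posx : ∃ a ∈ sx, 0 < a ∧ a ≠ ⊤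
  negx : ∃ a ∈ sx, a < 0 ∧ a ≠ ⊥
  posy : ∃ a ∈ sy, 0 < a ∧ a ≠ ⊤
  negy : ∃ a ∈ sy, a < 0 ∧ a ≠ ⊥

/-- A discrete bivariate quasi-distribution on the mesh `Δ`. -/
def DiscQuasiDist (Δ : Mesh) (F : EReal × EReal → ℝ) : Prop :=
  (∀ x ∈ Δ.sx, ∀ y ∈ Δ.sy, F (x, y) ∈ Set.Icc (0:ℝ) 1) ∧
  (∀ x ∈ Δ.sx, F (x, ⊥) = 0) ∧ (∀ y ∈ Δ.sy, F (⊥, y) = 0) ∧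
  F (⊤, ⊤) = 1 ∧
  (∀ a₁ ∈ Δ.sx, ∀ a₂ ∈ Δ.sx, ∀ b₁ ∈ Δ.sy, ∀ b₂ ∈ Δ.sy, a₁ ≤ a₂ → b₁ ≤ b₂ →
    (IsInfinite a₁ ∨ IsInfinite a₂ ∨ IsInfinite b₁ ∨ IsInfinite b₂) →
    0 ≤ vol F a₁ a₂ b₁ b₂)

/-- A discrete bivariate distribution on the mesh `Δ`. -/
def DiscDist (Δ : Mesh) (F : EReal × EReal → ℝ) : Prop :=
  (∀ x ∈ Δ.sx, ∀ y ∈ Δ.sy, F (x, y) ∈ Set.Icc (0:ℝ) 1) ∧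
  (∀ x ∈ Δ.sx, F (x, ⊥) = 0) ∧ (∀ y ∈ Δ.sy, F (⊥, y) = 0) ∧
  F (⊤, ⊤) = 1 ∧
  (∀ a₁ ∈ Δ.sx, ∀ a₂ ∈ Δ.sx, ∀ b₁ ∈ Δ.sy, ∀ b₂ ∈ Δ.sy, a₁ ≤ a₂ → b₁ ≤ b₂ →
    0 ≤ vol F a₁ a₂ b₁ b₂)

/-- All rectangles of the union have their corners in the mesh `Δ`. -/
def inMeshU (Δ : Mesh) (U : List Rect) : Prop :=
  ∀ R ∈ U, R.x1 ∈ Δ.sx ∧ R.x2 ∈ Δ.sx ∧ R.y1 ∈ Δ.sy ∧ R.y2 ∈ Δ.sy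

/-- The reflection `A^δ(x,y) = F_Y(y) − A(−x,y)` of `A` having second margin `FY`. -/
def reflectFun (FY : EReal → ℝ) (A : EReal × EReal → ℝ) : EReal × EReal → ℝ :=
  fun p => FY p.2 - A (-p.1, p.2)

end
/-- The increments of a quasi-distribution between two arbitrary points are controlled by the
positive parts of the increments of its margins. -/
theorem IsQuasiDist.le_add_posPart {F : EReal × EReal → ℝ} (hF : IsQuasiDist F)
    (p q : EReal × EReal) :
    F p ≤ F q + max (F (p.1, ⊤) - F (q.1, ⊤)) 0 + max (F (⊤, p.2) - F (⊤, q.2)) 0 := by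
  obtain ⟨-, hx0, h0y, -, hV⟩ := hF
  obtain ⟨a, b⟩ := p
  obtain ⟨x, y⟩ := q
  have first : F (a, b) ≤ F (x, b) + max (F (a, ⊤) - F (x, ⊤)) 0 := by
    rcases le_total a x with h | h
    · have := hV a x ⊥ b h bot_le (by simp [IsInfinite])
      simp only [vol, hx0] at this
      linarith [le_max_right (F (a, ⊤) - F (x, ⊤)) 0]
    · have := hV x a b ⊤ h le_top (by simp [IsInfinite])
      simp only [vol] at this
      linarith [le_max_left (F (a, ⊤) - F (x, ⊤)) 0]
  have second : F (x, b) ≤ F (x, y) + max (F (⊤, b) - F (⊤, y)) 0 := by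
    rcases le_total b y with h | h
    · have := hV ⊥ x b y bot_le h (by simp [IsInfinite])
      simp only [vol, h0y] at this
      linarith [le_max_right (F (⊤, b) - F (⊤, y)) 0]
    · have := hV x ⊤ y b le_top h (by simp [IsInfinite])
      simp only [vol] at this
      linarith [le_max_left (F (⊤, b) - F (⊤, y)) 0]
  linarith

/-- The penalized value at `p` whose infimum over `p` extends a quasi-distribution to the
unit square. -/
noncomputable def sklarCost (F : EReal × EReal → ℝ) (u v : ℝ) (p : EReal × EReal) : ℝ :=
  F p + max (u - F (p.1, ⊤)) 0 + max (v - F (⊤, p.2)) 0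

/-- The McShane-type extension of a quasi-distribution to the unit square. -/
noncomputable def sklarExtension (F : EReal × EReal → ℝ) (u v : ℝ) : ℝ :=
  ⨅ p, sklarCost F u v p

theorem sklarCost_nonneg {F : EReal × EReal → ℝ} (hF : IsQuasiDist F) (u v : ℝ)
    (p : EReal × EReal) : 0 ≤ sklarCost F u v p :=
  add_nonneg (add_nonneg (hF.1 p).1 (le_max_right _ _)) (le_max_right _ _)

theorem sklarExtension_le {F : EReal × EReal → ℝ} (hF : IsQuasiDist F) (u v : ℝ)
    (p : EReal × EReal) : sklarExtension F u v ≤ sklarCost F u v p :=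
  ciInf_le ⟨0, by rintro _ ⟨q, rfl⟩; exact sklarCost_nonneg hF u v q⟩ p

theorem sklarExtension_margins {F : EReal × EReal → ℝ} (hF : IsQuasiDist F)
    (p : EReal × EReal) : sklarExtension F (F (p.1, ⊤)) (F (⊤, p.2)) = F p :=
  le_antisymm ((sklarExtension_le hF _ _ p).trans (by simp [sklarCost]))
    (le_ciInf fun q => hF.le_add_posPart p q)

theorem sklarExtension_mono {F : EReal × EReal → ℝ} (hF : IsQuasiDist F) {u u' v v' : ℝ}
    (hu : u ≤ u') (hv : v ≤ v') : sklarExtension F u v ≤ sklarExtension F u' v' := by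
  refine le_ciInf fun p => (sklarExtension_le hF u v p).trans ?_
  unfold sklarCost
  gcongr

theorem sklarExtension_le_add {F : EReal × EReal → ℝ} (hF : IsQuasiDist F) (u u' v v' : ℝ) :
    sklarExtension F u v ≤ sklarExtension F u' v' + (|u - u'| + |v - v'|) := by
  have posPart_le (s t c : ℝ) : max (s - c) 0 ≤ max (t - c) 0 + |s - t| :=
    max_le (by linarith [le_abs_self (s - t), le_max_left (t - c) 0])
      (add_nonneg (le_max_right _ _) (abs_nonneg _))
  rw [← sub_le_iff_le_add]
  refine le_ciInf fun p => ?_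
  have h := sklarExtension_le hF u v p
  unfold sklarCost at h ⊢
  linarith [posPart_le u u' (F (p.1, ⊤)), posPart_le v v' (F (⊤, p.2))]

theorem sklarExtension_isQuasiCopula {F : EReal × EReal → ℝ} (hF : IsQuasiDist F) :
    IsQuasiCopula (sklarExtension F) := by
  have nonneg (u v : ℝ) : 0 ≤ sklarExtension F u v :=
    le_ciInf fun p => sklarCost_nonneg hF u v p
  have hx0 := hF.2.1
  have h0y := hF.2.2.1
  have h1 := hF.2.2.2.1
  have hoeffding (p : EReal × EReal) : F (p.1, ⊤) + F (⊤, p.2) ≤ F p + 1 := by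
    have := hF.2.2.2.2 p.1 ⊤ p.2 ⊤ le_top le_top (by simp [IsInfinite])
    simp only [vol, h1] at this
    linarith
  refine ⟨fun u hu v hv => ⟨nonneg u v, ?_⟩, fun u hu => ⟨?_, ?_, ?_, ?_⟩,
    fun u _ u' _ v _ h =>
      ⟨sklarExtension_mono hF h le_rfl, sklarExtension_mono hF le_rfl h⟩,
    fun u _ u' _ v _ v' _ => abs_sub_le_iff.2 ⟨?_, ?_⟩⟩
  · refine (sklarExtension_le hF u v (⊤, ⊤)).trans_eq ?_
    simp [sklarCost, h1, hu.2, hv.2]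
  · refine le_antisymm ((sklarExtension_le hF u 0 (⊤, ⊥)).trans_eq ?_) (nonneg _ _)
    simp [sklarCost, h1, hx0, hu.2]
  · refine le_antisymm ((sklarExtension_le hF 0 u (⊥, ⊤)).trans_eq ?_) (nonneg _ _)
    simp [sklarCost, h1, h0y, hu.2]
  · refine le_antisymm ((sklarExtension_le hF u 1 (⊥, ⊤)).trans_eq ?_) (le_ciInf fun p => ?_)
    · simp [sklarCost, h1, h0y, hu.1]
    · unfold sklarCost
      linarith [hoeffding p, le_max_left (u - F (p.1, ⊤)) 0, le_max_left (1 - F (⊤, p.2)) 0]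
  · refine le_antisymm ((sklarExtension_le hF 1 u (⊤, ⊥)).trans_eq ?_) (le_ciInf fun p => ?_)
    · simp [sklarCost, h1, hx0, hu.1]
    · unfold sklarCost
      linarith [hoeffding p, le_max_left (1 - F (p.1, ⊤)) 0, le_max_left (u - F (⊤, p.2)) 0]
  · linarith [sklarExtension_le_add hF u u' v v']
  · have := sklarExtension_le_add hF u' u v' v
    rw [abs_sub_comm u' u, abs_sub_comm v' v] at this
    linarith

/-- **Sklar's theorem for quasi-distributions** (Theorem `sklar_quasi`, quasi-copula part):
every bivariate quasi-distribution `F` with margins `FX`, `FY` can be written as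
`F(x,y) = C(FX(x), FY(y))` for some quasi-copula `C`. -/
theorem sklar_for_quasi_distributions
    (F : EReal × EReal → ℝ) (FX FY : EReal → ℝ)
    (hF : IsQuasiDist F) (hm : HasMargins F FX FY) :
    ∃ C : ℝ → ℝ → ℝ, IsQuasiCopula C ∧
      ∀ p : EReal × EReal, F p = C (FX p.1) (FY p.2) := by
  refine ⟨sklarExtension F, sklarExtension_isQuasiCopula hF, fun p => ?_⟩
  rw [← hm.1, ← hm.2, sklarExtension_margins hF]
end

section
/- Sklar's theorem for (possibly non-right-continuous) distributions: Let F be a bivariate distribution with margins F_X and F_Y (right-continuity is not assumed, so F may arise from a merely finitely additive probability). Then there exists a copula C such that F(x,y) = C(F_X(x), F_Y(y)) for all (x,y) ∈ R̄². -/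
open scoped Classical

/-- The largest point of `K` below `u` (for `K` closed). -/
noncomputable def lowerPoint (K : Set ℝ) (u : ℝ) : ℝ := sSup (K ∩ Set.Iic u)

/-- The smallest point of `K` above `u` (for `K` closed). -/
noncomputable def upperPoint (K : Set ℝ) (u : ℝ) : ℝ := sInf (K ∩ Set.Ici u)

/-- Affine interpolation of `h` across the gaps of `K`. -/
noncomputable def interpolate (K : Set ℝ) (h : ℝ → ℝ) (u : ℝ) : ℝ :=
  h (lowerPoint K u) + (u - lowerPoint K u) / (upperPoint K u - lowerPoint K u) *
    (h (upperPoint K u) - h (lowerPoint K u))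

section Interpolation

variable {K : Set ℝ} {u : ℝ}

theorem isGreatest_lowerPoint (hK : IsClosed K) (h0 : (0 : ℝ) ∈ K)
    (hu : u ∈ Set.Icc (0 : ℝ) 1) : IsGreatest (K ∩ Set.Iic u) (lowerPoint K u) :=
  have hb : BddAbove (K ∩ Set.Iic u) := ⟨u, fun _ hx => hx.2⟩
  ⟨(hK.inter isClosed_Iic).csSup_mem ⟨0, h0, hu.1⟩ hb, fun _ hx => le_csSup hb hx⟩

theorem isLeast_upperPoint (hK : IsClosed K) (h1 : (1 : ℝ) ∈ K)
    (hu : u ∈ Set.Icc (0 : ℝ) 1) : IsLeast (K ∩ Set.Ici u) (upperPoint K u) :=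
  have hb : BddBelow (K ∩ Set.Ici u) := ⟨u, fun _ hx => hx.2⟩
  ⟨(hK.inter isClosed_Ici).csInf_mem ⟨1, h1, hu.2⟩ hb, fun _ hx => csInf_le hb hx⟩

theorem interpolate_of_mem (h : ℝ → ℝ) (hu : u ∈ K) : interpolate K h u = h u := by
  have hl : lowerPoint K u = u :=
    IsGreatest.csSup_eq ⟨⟨hu, le_refl u⟩, fun _ hx => hx.2⟩
  have hr : upperPoint K u = u :=
    IsLeast.csInf_eq ⟨⟨hu, le_refl u⟩, fun _ hx => hx.2⟩
  simp [interpolate, hl, hr]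

theorem interpolate_sub (h g : ℝ → ℝ) :
    interpolate K (fun s => h s - g s) u = interpolate K h u - interpolate K g u := by
  simp only [interpolate]
  ring

theorem interpolate_congr (hK : IsClosed K) (h0 : (0 : ℝ) ∈ K) (h1 : (1 : ℝ) ∈ K)
    (hu : u ∈ Set.Icc (0 : ℝ) 1) {h g : ℝ → ℝ} (hg : Set.EqOn h g K) :
    interpolate K h u = interpolate K g u := by
  simp only [interpolate, hg (isGreatest_lowerPoint hK h0 hu).1.1,
    hg (isLeast_upperPoint hK h1 hu).1.1]

theorem interpolate_id (hK : IsClosed K) (h0 : (0 : ℝ) ∈ K) (h1 : (1 : ℝ) ∈ K)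
    (hu : u ∈ Set.Icc (0 : ℝ) 1) : interpolate K (fun s => s) u = u := by
  have hl : lowerPoint K u ≤ u := (isGreatest_lowerPoint hK h0 hu).1.2
  have hr : u ≤ upperPoint K u := (isLeast_upperPoint hK h1 hu).1.2
  simp only [interpolate]
  rcases eq_or_ne (upperPoint K u - lowerPoint K u) 0 with h | h
  · rw [h]; linarith
  · rw [div_mul_cancel₀ _ h]; ring

theorem interpolate_mem_Icc (hK : IsClosed K) (h0 : (0 : ℝ) ∈ K) (h1 : (1 : ℝ) ∈ K)
    (hu : u ∈ Set.Icc (0 : ℝ) 1) {h : ℝ → ℝ} (hh : MonotoneOn h K) :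
    interpolate K h u ∈ Set.Icc (h (lowerPoint K u)) (h (upperPoint K u)) := by
  obtain ⟨⟨hlK, hl⟩, -⟩ := isGreatest_lowerPoint hK h0 hu
  obtain ⟨⟨hrK, hr⟩, -⟩ := isLeast_upperPoint hK h1 hu
  rw [Set.mem_Iic] at hl
  rw [Set.mem_Ici] at hr
  have hle := hh hlK hrK (hl.trans hr)
  have hw0 : 0 ≤ (u - lowerPoint K u) / (upperPoint K u - lowerPoint K u) :=
    div_nonneg (by linarith) (by linarith)
  have hw1 : (u - lowerPoint K u) / (upperPoint K u - lowerPoint K u) ≤ 1 :=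
    div_le_one_of_le₀ (by linarith) (by linarith)
  simp only [interpolate]
  constructor <;> nlinarith

theorem monotoneOn_interpolate (hK : IsClosed K) (h0 : (0 : ℝ) ∈ K) (h1 : (1 : ℝ) ∈ K)
    {h : ℝ → ℝ} (hh : MonotoneOn h K) :
    MonotoneOn (interpolate K h) (Set.Icc 0 1) := by
  intro u hu u' hu' huu'
  by_cases hc : ∃ c ∈ K, u ≤ c ∧ c ≤ u'
  · obtain ⟨c, hcK, huc, hcu'⟩ := hc
    have hr := isLeast_upperPoint hK h1 hu
    have hl := isGreatest_lowerPoint hK h0 hu'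
    calc interpolate K h u ≤ h (upperPoint K u) := (interpolate_mem_Icc hK h0 h1 hu hh).2
      _ ≤ h c := hh hr.1.1 hcK (hr.2 ⟨hcK, huc⟩)
      _ ≤ h (lowerPoint K u') := hh hcK hl.1.1 (hl.2 ⟨hcK, hcu'⟩)
      _ ≤ interpolate K h u' := (interpolate_mem_Icc hK h0 h1 hu' hh).1
  · push Not at hc
    have hl : lowerPoint K u' = lowerPoint K u := by
      unfold lowerPoint
      congr 1
      ext x
      refine and_congr_right fun hx => ⟨fun hxu => ?_, fun hxu => le_trans hxu huu'⟩
      exact le_of_not_ge fun hux => absurd (hc x hx hux) (not_lt.mpr hxu)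
    have hr : upperPoint K u' = upperPoint K u := by
      unfold upperPoint
      congr 1
      ext x
      exact and_congr_right fun hx => ⟨fun hxu => huu'.trans hxu, fun hxu => (hc x hx hxu).le⟩
    obtain ⟨⟨hlK, hl'⟩, -⟩ := isGreatest_lowerPoint hK h0 hu
    obtain ⟨⟨hrK, hr'⟩, -⟩ := isLeast_upperPoint hK h1 hu
    have hlr : lowerPoint K u ≤ upperPoint K u := le_trans hl' hr'
    have hle := hh hlK hrK hlr
    simp only [interpolate, hl, hr]
    gcongr

end Interpolation

/-- A continuous grounded 2-increasing function with uniform margins on a product of closed sets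
containing `0` and `1` interpolates to a copula. -/
theorem isCopula_interpolate {K L : Set ℝ} (hK : IsClosed K) (hL : IsClosed L)
    (hK0 : (0 : ℝ) ∈ K) (hK1 : (1 : ℝ) ∈ K) (hL0 : (0 : ℝ) ∈ L) (hL1 : (1 : ℝ) ∈ L)
    {H : ℝ → ℝ → ℝ} (hs0 : ∀ s ∈ K, H s 0 = 0) (h0t : ∀ t ∈ L, H 0 t = 0)
    (hs1 : ∀ s ∈ K, H s 1 = s) (h1t : ∀ t ∈ L, H 1 t = t)
    (hH : ∀ s₁ ∈ K, ∀ s₂ ∈ K, ∀ t₁ ∈ L, ∀ t₂ ∈ L, s₁ ≤ s₂ → t₁ ≤ t₂ →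
      0 ≤ H s₂ t₂ - H s₁ t₂ - H s₂ t₁ + H s₁ t₁) :
    IsCopula fun u v => interpolate K (fun s => interpolate L (H s) v) u := by
  have hz : ∀ {M : Set ℝ} {u : ℝ}, interpolate M (fun _ => 0) u = 0 := by simp [interpolate]
  have hmargins : ∀ u ∈ Set.Icc (0 : ℝ) 1,
      interpolate K (fun s => interpolate L (H s) 0) u = 0 ∧
      interpolate K (fun s => interpolate L (H s) u) 0 = 0 ∧
      interpolate K (fun s => interpolate L (H s) 1) u = u ∧
      interpolate K (fun s => interpolate L (H s) u) 1 = u := by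
    intro u hu
    refine ⟨?_, ?_, ?_, ?_⟩
    · simp only [interpolate_of_mem _ hL0]
      rw [interpolate_congr hK hK0 hK1 hu hs0, hz]
    · rw [interpolate_of_mem _ hK0, interpolate_congr hL hL0 hL1 hu h0t, hz]
    · simp only [interpolate_of_mem _ hL1]
      rw [interpolate_congr hK hK0 hK1 hu hs1, interpolate_id hK hK0 hK1 hu]
    · rw [interpolate_of_mem _ hK1, interpolate_congr hL hL0 hL1 hu h1t,
        interpolate_id hL hL0 hL1 hu]
  have hvol : ∀ u₁ ∈ Set.Icc (0 : ℝ) 1, ∀ u₂ ∈ Set.Icc (0 : ℝ) 1, ∀ v₁ ∈ Set.Icc (0 : ℝ) 1,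
      ∀ v₂ ∈ Set.Icc (0 : ℝ) 1, u₁ ≤ u₂ → v₁ ≤ v₂ →
      0 ≤ interpolate K (fun s => interpolate L (H s) v₂) u₂
        - interpolate K (fun s => interpolate L (H s) v₂) u₁
        - interpolate K (fun s => interpolate L (H s) v₁) u₂
        + interpolate K (fun s => interpolate L (H s) v₁) u₁ := by
    intro u₁ hu₁ u₂ hu₂ v₁ hv₁ v₂ hv₂ hu hv
    have hmono : MonotoneOn (fun s => interpolate L (H s) v₂ - interpolate L (H s) v₁) K := by
      intro s₁ hs₁ s₂ hs₂ hs
      have hdiff : MonotoneOn (fun t => H s₂ t - H s₁ t) L := fun t₁ ht₁ t₂ ht₂ ht => by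
        have := hH s₁ hs₁ s₂ hs₂ t₁ ht₁ t₂ ht₂ hs ht
        simp only
        linarith
      have := monotoneOn_interpolate hL hL0 hL1 hdiff hv₁ hv₂ hv
      rw [interpolate_sub, interpolate_sub] at this
      simp only
      linarith
    have := monotoneOn_interpolate hK hK0 hK1 hmono hu₁ hu₂ hu
    rw [interpolate_sub, interpolate_sub] at this
    linarith
  refine ⟨fun u hu v hv => ?_, hmargins, hvol⟩
  have zero_mem : (0 : ℝ) ∈ Set.Icc (0 : ℝ) 1 := by simp
  have one_mem : (1 : ℝ) ∈ Set.Icc (0 : ℝ) 1 := by simp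
  have h₁ := hvol 0 zero_mem u hu 0 zero_mem v hv hu.1 hv.1
  have h₂ := hvol u hu 1 one_mem 0 zero_mem v hv hu.2 hv.1
  obtain ⟨-, h0v, -, h1v⟩ := hmargins v hv
  have hu0 := (hmargins u hu).1
  have h00 := (hmargins 0 zero_mem).1
  have h10 := (hmargins 1 one_mem).1
  constructor
  · linarith
  · linarith [hv.2]

/-- A distribution is 1-Lipschitz in its margins. -/
theorem IsDist.abs_sub_le {F : EReal × EReal → ℝ} (hF : IsDist F) (x x' y y' : EReal) :
    |F (x, y) - F (x', y')| ≤ |F (x, ⊤) - F (x', ⊤)| + |F (⊤, y) - F (⊤, y')| := by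
  obtain ⟨-, hx0, h0y, -, hV⟩ := hF
  have left : ∀ x x', |F (x, y) - F (x', y)| ≤ |F (x, ⊤) - F (x', ⊤)| := by
    intro x x'
    wlog h : x' ≤ x generalizing x x'
    · rw [abs_sub_comm, abs_sub_comm (F (x, ⊤))]
      exact this x' x (le_of_not_ge h)
    have h₁ := hV x' x ⊥ y h bot_le
    have h₂ := hV x' x y ⊤ h le_top
    simp only [vol, hx0] at h₁ h₂
    rw [abs_of_nonneg (by linarith), abs_of_nonneg (by linarith)]
    linarith
  have right : ∀ y y', |F (x', y) - F (x', y')| ≤ |F (⊤, y) - F (⊤, y')| := by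
    intro y y'
    wlog h : y' ≤ y generalizing y y'
    · rw [abs_sub_comm, abs_sub_comm (F (⊤, y))]
      exact this y' y (le_of_not_ge h)
    have h₁ := hV ⊥ x' y' y bot_le h
    have h₂ := hV x' ⊤ y' y le_top h
    simp only [vol, h0y] at h₁ h₂
    rw [abs_of_nonneg (by linarith), abs_of_nonneg (by linarith)]
    linarith
  exact (_root_.abs_sub_le _ (F (x', y)) _).trans (add_le_add (left x x') (right y y'))

/-- A distribution is a continuous function of its margins. -/
theorem IsDist.exists_continuous_eq {F : EReal × EReal → ℝ} (hF : IsDist F) :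
    ∃ H : ℝ × ℝ → ℝ, Continuous H ∧ ∀ x y, H (F (x, ⊤), F (⊤, y)) = F (x, y) := by
  set f : EReal → ℝ := fun x => F (x, ⊤) with hf
  set g : EReal → ℝ := fun y => F (⊤, y) with hg
  have hinv : ∀ x y, F (f.invFun (f x), g.invFun (g y)) = F (x, y) := by
    intro x y
    have h := hF.abs_sub_le (f.invFun (f x)) x (g.invFun (g y)) y
    have hx : f (f.invFun (f x)) = f x := Function.invFun_eq ⟨x, rfl⟩
    have hy : g (g.invFun (g y)) = g y := Function.invFun_eq ⟨y, rfl⟩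
    simp only [hf, hg] at hx hy
    rw [hx, hy, sub_self, sub_self, abs_zero, add_zero] at h
    exact sub_eq_zero.mp (abs_nonpos_iff.mp h)
  have hlip : LipschitzOnWith 2 (fun p : ℝ × ℝ => F (f.invFun p.1, g.invFun p.2))
      (Set.range f ×ˢ Set.range g) := by
    refine LipschitzOnWith.of_dist_le_mul ?_
    rintro ⟨-, -⟩ ⟨⟨x, rfl⟩, ⟨y, rfl⟩⟩ ⟨-, -⟩ ⟨⟨x', rfl⟩, ⟨y', rfl⟩⟩
    simp only [hinv, Real.dist_eq, Prod.dist_eq]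
    have h := hF.abs_sub_le x x' y y'
    have h₁ := le_max_left |f x - f x'| |g y - g y'|
    have h₂ := le_max_right |f x - f x'| |g y - g y'|
    push_cast
    linarith
  obtain ⟨H, hH, heq⟩ := hlip.extend_real
  refine ⟨H, hH.continuous, fun x y => ?_⟩
  rw [← hinv x y]
  exact (heq ⟨⟨x, rfl⟩, ⟨y, rfl⟩⟩).symm

/-- For continuous functions, being 2-increasing passes to closures. -/
theorem volume_nonneg_closure {H : ℝ × ℝ → ℝ} (hH : Continuous H) {S T : Set ℝ}
    (hV : ∀ s₁ ∈ S, ∀ s₂ ∈ S, ∀ t₁ ∈ T, ∀ t₂ ∈ T, s₁ ≤ s₂ → t₁ ≤ t₂ →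
      0 ≤ H (s₂, t₂) - H (s₁, t₂) - H (s₂, t₁) + H (s₁, t₁)) :
    ∀ s₁ ∈ closure S, ∀ s₂ ∈ closure S, ∀ t₁ ∈ closure T, ∀ t₂ ∈ closure T,
      s₁ ≤ s₂ → t₁ ≤ t₂ → 0 ≤ H (s₂, t₂) - H (s₁, t₂) - H (s₂, t₁) + H (s₁, t₁) := by
  intro s₁ hs₁ s₂ hs₂ t₁ ht₁ t₂ ht₂ hs ht
  let V : (ℝ × ℝ) × (ℝ × ℝ) → ℝ := fun p =>
    H (max p.1.1 p.1.2, max p.2.1 p.2.2) - H (min p.1.1 p.1.2, max p.2.1 p.2.2)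
      - H (max p.1.1 p.1.2, min p.2.1 p.2.2) + H (min p.1.1 p.1.2, min p.2.1 p.2.2)
  have hVc : IsClosed {p | 0 ≤ V p} := isClosed_le continuous_const (by fun_prop)
  have hsub : closure ((S ×ˢ S) ×ˢ (T ×ˢ T)) ⊆ {p | 0 ≤ V p} := by
    refine closure_minimal ?_ hVc
    rintro ⟨⟨a, b⟩, c, d⟩ ⟨⟨ha, hb⟩, hc, hd⟩
    refine hV _ ?_ _ ?_ _ ?_ _ ?_ min_le_max min_le_max
    · rcases min_choice a b with h | h <;> simpa only [h]
    · rcases max_choice a b with h | h <;> simpa only [h]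
    · rcases min_choice c d with h | h <;> simpa only [h]
    · rcases max_choice c d with h | h <;> simpa only [h]
  have hmem : ((s₁, s₂), (t₁, t₂)) ∈ closure ((S ×ˢ S) ×ˢ (T ×ˢ T)) := by
    simp only [closure_prod_eq]
    exact ⟨⟨hs₁, hs₂⟩, ht₁, ht₂⟩
  simpa [V, hs, ht] using hsub hmem

/-- **Sklar's theorem for (possibly non-right-continuous) distributions**:
every bivariate distribution `F` with margins `FX`, `FY` can be written as
`F(x,y) = C(FX(x), FY(y))` for some copula `C`. -/
theorem sklar_for_distributions
    (F : EReal × EReal → ℝ) (FX FY : EReal → ℝ)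
    (hF : IsDist F) (hm : HasMargins F FX FY) :
    ∃ C : ℝ → ℝ → ℝ, IsCopula C ∧
      ∀ p : EReal × EReal, F p = C (FX p.1) (FY p.2) := by
  obtain ⟨H, hHc, hHF⟩ := hF.exists_continuous_eq
  obtain ⟨-, hx0, h0y, h11, hV⟩ := hF
  obtain ⟨hX, hY⟩ := hm
  simp only [hX, hY] at hHF
  have mono_X : Monotone FX := fun a b hab => by
    have := hV a b ⊥ ⊤ hab bot_le
    simp only [vol, hx0, hX] at this
    linarith
  have mono_Y : Monotone FY := fun a b hab => by
    have := hV ⊥ ⊤ a b bot_le hab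
    simp only [vol, h0y, hY] at this
    linarith
  have hX0 : FX ⊥ = 0 := by rw [← hX, h0y]
  have hX1 : FX ⊤ = 1 := by rw [← hX, h11]
  have hY0 : FY ⊥ = 0 := by rw [← hY, hx0]
  have hY1 : FY ⊤ = 1 := by rw [← hY, h11]
  have hX_mem : ∀ x, FX x ∈ closure (Set.range FX) := fun x => subset_closure ⟨x, rfl⟩
  have hY_mem : ∀ y, FY y ∈ closure (Set.range FY) := fun y => subset_closure ⟨y, rfl⟩
  refine ⟨fun u v => interpolate (closure (Set.range FX))
    (fun s => interpolate (closure (Set.range FY)) (fun t => H (s, t)) v) u, ?_, ?_⟩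
  · refine isCopula_interpolate (H := fun s t => H (s, t)) isClosed_closure isClosed_closure
      (hX0 ▸ hX_mem ⊥) (hX1 ▸ hX_mem ⊤) (hY0 ▸ hY_mem ⊥) (hY1 ▸ hY_mem ⊤) ?_ ?_ ?_ ?_ ?_
    · refine Set.EqOn.closure (f := fun s => H (s, 0)) (g := fun _ => 0) ?_
        (by fun_prop) (by fun_prop)
      rintro - ⟨x, rfl⟩
      simp only [← hY0, hHF, hx0]
    · refine Set.EqOn.closure (f := fun t => H (0, t)) (g := fun _ => 0) ?_
        (by fun_prop) (by fun_prop)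
      rintro - ⟨y, rfl⟩
      simp only [← hX0, hHF, h0y]
    · refine Set.EqOn.closure (f := fun s => H (s, 1)) (g := fun s => s) ?_
        (by fun_prop) (by fun_prop)
      rintro - ⟨x, rfl⟩
      simp only [← hY1, hHF, hX]
    · refine Set.EqOn.closure (f := fun t => H (1, t)) (g := fun t => t) ?_
        (by fun_prop) (by fun_prop)
      rintro - ⟨y, rfl⟩
      simp only [← hX1, hHF, hY]
    · refine volume_nonneg_closure hHc ?_
      rintro - ⟨x₁, rfl⟩ - ⟨x₂, rfl⟩ - ⟨y₁, rfl⟩ - ⟨y₂, rfl⟩ hx hy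
      simp only [hHF]
      rcases le_total x₁ x₂ with h | h
      · rcases le_total y₁ y₂ with h' | h'
        · exact hV x₁ x₂ y₁ y₂ h h'
        · have e : FY y₁ = FY y₂ := le_antisymm hy (mono_Y h')
          simp only [← hHF, e]
          linarith
      · have e : FX x₁ = FX x₂ := le_antisymm hx (mono_X h)
        simp only [← hHF, e]
        linarith
  · rintro ⟨x, y⟩
    simp only [interpolate_of_mem _ (hX_mem x), interpolate_of_mem _ (hY_mem y), hHF]
end

section
/- Let F_X, F_Y be fixed univariate margins such that the set 𝔔^{F_X,F_Y} of all bivariate quasi-distributions with margins F_X and F_Y is nonempty. Then 𝔔^{F_X,F_Y} is compact in the uniform (sup) metric on bounded functions R̄² → ℝ. -/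
open scoped Classical

open Filter Topology in
/-- A family of real functions that is uniformly Lipschitz with respect to a map `φ` with totally
bounded range, and that is compact for pointwise convergence, is compact for uniform convergence. -/
theorem UniformFun.isCompact_of_forall_dist_le {X E : Type*} [PseudoMetricSpace E] {φ : X → E}
    (hφ : TotallyBounded (Set.range φ)) {S : Set (X → ℝ)} (hS : IsCompact S) (K : ℝ)
    (hlip : ∀ F ∈ S, ∀ p q, dist (F p) (F q) ≤ K * dist (φ p) (φ q)) :
    IsCompact {F : UniformFun X ℝ | UniformFun.toFun F ∈ S} := by
  rw [isCompact_iff_ultrafilter_le_nhds]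
  intro f hf
  have hfS : ∀ᶠ F : UniformFun X ℝ in f, UniformFun.toFun F ∈ S := le_principal_iff.1 hf
  obtain ⟨G, hGS, hG⟩ := hS.ultrafilter_le_nhds (f.map UniformFun.toFun)
    (le_principal_iff.2 hfS)
  have hG' : Tendsto (fun F : UniformFun X ℝ => UniformFun.toFun F) f (𝓝 G) := hG
  rw [tendsto_pi_nhds] at hG'
  refine ⟨UniformFun.ofFun G, hGS, ?_⟩
  suffices Tendsto (id : UniformFun X ℝ → UniformFun X ℝ) f (𝓝 (UniformFun.ofFun G)) from this
  rw [UniformFun.tendsto_iff_tendstoUniformly, Metric.tendstoUniformly_iff]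
  intro ε hε
  have hδ : 0 < ε / 3 / (|K| + 1) := by positivity
  obtain ⟨t, ht, htfin, hcov⟩ := Metric.finite_approx_of_totallyBounded hφ _ hδ
  obtain ⟨s, hsfin, rfl⟩ : ∃ s : Set X, s.Finite ∧ φ '' s = t := by
    rw [← Set.image_univ] at ht
    obtain ⟨s, -, hsfin, hs⟩ := Set.Finite.exists_subset_finite_image_eq htfin ht
    exact ⟨s, hsfin, hs⟩
  have hev : ∀ᶠ F : UniformFun X ℝ in f, ∀ p ∈ s, dist (UniformFun.toFun F p) (G p) < ε / 3 :=
    hsfin.eventually_all.2 fun p _ => Metric.tendsto_nhds.1 (hG' p) _ (by positivity)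
  filter_upwards [hev, hfS] with F hF hFS q
  obtain ⟨_, ⟨p, hp, rfl⟩, hpq⟩ := Set.mem_iUnion₂.1 (hcov ⟨q, rfl⟩)
  rw [Metric.mem_ball] at hpq
  have hbound : ∀ H ∈ S, dist (H q) (H p) ≤ ε / 3 := fun H hH => calc
    dist (H q) (H p) ≤ K * dist (φ q) (φ p) := hlip H hH q p
    _ ≤ (|K| + 1) * (ε / 3 / (|K| + 1)) := by
      gcongr
      exact (le_abs_self K).trans (by linarith)
    _ = ε / 3 := by field_simp
  have h1 := hbound G hGS
  have h2 := hbound _ hFS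
  have h3 := hF p hp
  rw [dist_comm] at h2 h3
  calc dist (G q) (UniformFun.toFun F q)
      ≤ dist (G q) (G p) + dist (G p) (UniformFun.toFun F p)
        + dist (UniformFun.toFun F p) (UniformFun.toFun F q) := dist_triangle4 _ _ _ _
    _ < ε := by linarith

/-- The set of quasi-distributions with given margins is closed under pointwise limits. -/
theorem isClosed_setOf_isQuasiDist_hasMargins (FX FY : EReal → ℝ) :
    IsClosed {F : EReal × EReal → ℝ | IsQuasiDist F ∧ HasMargins F FX FY} := by
  simp only [IsQuasiDist, HasMargins, vol, Set.mem_Icc, Set.ofPred_and, Set.ofPred_forall]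
  refine .inter (.inter ?_ (.inter ?_ (.inter ?_ (.inter ?_ ?_)))) (.inter ?_ ?_)
  · exact isClosed_iInter fun p => (isClosed_le (by fun_prop) (by fun_prop)).inter
      (isClosed_le (by fun_prop) (by fun_prop))
  · exact isClosed_iInter fun _ => isClosed_eq (by fun_prop) (by fun_prop)
  · exact isClosed_iInter fun _ => isClosed_eq (by fun_prop) (by fun_prop)
  · exact isClosed_eq (by fun_prop) (by fun_prop)
  · exact isClosed_iInter fun _ => isClosed_iInter fun _ => isClosed_iInter fun _ =>
      isClosed_iInter fun _ => isClosed_iInter fun _ => isClosed_iInter fun _ =>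
      isClosed_iInter fun _ => isClosed_le (by fun_prop) (by fun_prop)
  · exact isClosed_iInter fun _ => isClosed_eq (by fun_prop) (by fun_prop)
  · exact isClosed_iInter fun _ => isClosed_eq (by fun_prop) (by fun_prop)

/-- A quasi-distribution varies in its first argument at most as much as its first margin. -/
theorem IsQuasiDist.dist_fst_le {F : EReal × EReal → ℝ} (hF : IsQuasiDist F) (x x' y : EReal) :
    dist (F (x, y)) (F (x', y)) ≤ dist (F (x, ⊤)) (F (x', ⊤)) := by
  wlog h : x' ≤ x generalizing x x'
  · rw [dist_comm, dist_comm (F (x, ⊤))]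
    exact this x' x (le_of_not_ge h)
  obtain ⟨-, hbot, -, -, hvol⟩ := hF
  have h1 := hvol x' x ⊥ y h bot_le (by simp [IsInfinite])
  have h2 := hvol x' x y ⊤ h le_top (by simp [IsInfinite])
  simp only [vol, hbot] at h1 h2
  rw [Real.dist_eq, Real.dist_eq]
  exact abs_le_abs_of_nonneg (by linarith) (by linarith)

/-- A quasi-distribution varies in its second argument at most as much as its second margin. -/
theorem IsQuasiDist.dist_snd_le {F : EReal × EReal → ℝ} (hF : IsQuasiDist F) (x y y' : EReal) :
    dist (F (x, y)) (F (x, y')) ≤ dist (F (⊤, y)) (F (⊤, y')) := by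
  wlog h : y' ≤ y generalizing y y'
  · rw [dist_comm, dist_comm (F (⊤, y))]
    exact this y' y (le_of_not_ge h)
  obtain ⟨-, -, hbot, -, hvol⟩ := hF
  have h1 := hvol ⊥ x y' y bot_le h (by simp [IsInfinite])
  have h2 := hvol x ⊤ y' y le_top h (by simp [IsInfinite])
  simp only [vol, hbot] at h1 h2
  rw [Real.dist_eq, Real.dist_eq]
  exact abs_le_abs_of_nonneg (by linarith) (by linarith)

/-- The set `𝔔^{F_X,F_Y}` of quasi-distributions with fixed margins is compact in the
topology of uniform convergence (the uniform/sup metric). -/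
theorem quasiDist_set_isCompact (FX FY : EReal → ℝ)
    (hne : ∃ F : EReal × EReal → ℝ, IsQuasiDist F ∧ HasMargins F FX FY) :
    IsCompact {F : UniformFun (EReal × EReal) ℝ |
      IsQuasiDist (UniformFun.toFun F) ∧ HasMargins (UniformFun.toFun F) FX FY} := by
  obtain ⟨F₀, hF₀, hX₀, hY₀⟩ := hne
  refine UniformFun.isCompact_of_forall_dist_le
    (φ := fun p : EReal × EReal => (FX p.1, FY p.2))
    (S := {F | IsQuasiDist F ∧ HasMargins F FX FY}) ?_ ?_ 2 ?_
  · refine (isCompact_Icc (a := ((0 : ℝ), (0 : ℝ))) (b := (1, 1))).totallyBounded.subset ?_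
    rintro _ ⟨p, rfl⟩
    have h1 := hF₀.1 (p.1, ⊤)
    have h2 := hF₀.1 (⊤, p.2)
    rw [hX₀] at h1
    rw [hY₀] at h2
    exact ⟨⟨h1.1, h2.1⟩, ⟨h1.2, h2.2⟩⟩
  · exact (isCompact_univ_pi fun _ => isCompact_Icc).of_isClosed_subset
      (isClosed_setOf_isQuasiDist_hasMargins FX FY) fun F hF p _ => hF.1.1 p
  · rintro F ⟨hF, hX, hY⟩ ⟨x, y⟩ ⟨x', y'⟩
    have h1 := hF.dist_fst_le x x' y
    have h2 := hF.dist_snd_le x' y y'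
    rw [hX, hX] at h1
    rw [hY, hY] at h2
    have h3 := dist_triangle (F (x, y)) (F (x', y)) (F (x', y'))
    have h4 := le_max_left (dist (FX x) (FX x')) (dist (FY y) (FY y'))
    have h5 := le_max_right (dist (FX x) (FX x')) (dist (FY y) (FY y'))
    rw [Prod.dist_eq]
    linarith
end

section
/- Key modification lemma: Let A, B : R̄² → ℝ satisfy conditions (Q1) and (Q2), and suppose there exists a point x ∈ R̄² with t₀ = γ^{(A,B)}(x) > 0. For 0 < t ≤ t₀ define A' : R̄² → ℝ by A'(x) = A(x) + t and A'(y) = A(y) for y ≠ x. Then the pair (A', B) again satisfies conditions (Q1) and (Q2); moreover, if t = t₀ then γ^{(A',B)}(x) = 0. -/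
open scoped Classical

lemma Rect.mult_eq_zero_of_notMem {R : Rect} {p : EReal × EReal} (h : p ∉ R.cornerList) :
    R.mult p = 0 := by
  simp only [Rect.cornerList, List.mem_cons, List.not_mem_nil, or_false, not_or] at h
  simp [Rect.mult, h]

lemma multU_eq_zero_of_notMem {U : List Rect} {p : EReal × EReal} (h : p ∉ cornersU U) :
    multU U p = 0 := by
  simp only [cornersU, List.mem_toFinset, List.mem_flatMap, not_exists, not_and] at h
  refine List.sum_eq_zero fun n hn => ?_
  obtain ⟨R, hR, rfl⟩ := List.mem_map.1 hn
  exact Rect.mult_eq_zero_of_notMem (h R hR)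

/-- Only the value of `A` at points of negative multiplicity enters `L^{(A,B)}(R)`. -/
lemma Lval_add_single_left {A B A' : EReal × EReal → ℝ} {x : EReal × EReal} {t : ℝ}
    (hA' : ∀ y, A' y = if y = x then A x + t else A y) (U : List Rect) :
    Lval A' B U = Lval A B U + if multU U x < 0 then t * (multU U x : ℝ) else 0 := by
  have hsum : (if multU U x < 0 then t * (multU U x : ℝ) else 0) =
      ∑ p ∈ cornersU U, if p = x then (if multU U x < 0 then t * (multU U x : ℝ) else 0) else 0 := by
    rw [Finset.sum_ite_eq']
    by_cases hx : x ∈ cornersU U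
    · simp [hx]
    · simp [multU_eq_zero_of_notMem hx]
  rw [hsum, Lval, Lval, ← Finset.sum_add_distrib]
  refine Finset.sum_congr rfl fun p _ => ?_
  rw [hA' p]
  by_cases hp : p = x
  · subst hp
    simp only [if_true]
    split_ifs
    · omega
    · ring
    · ring
    · ring
  · simp [hp]

lemma mul_neg_multU_le_Lval {A B : EReal × EReal → ℝ} {x : EReal × EReal} {t : ℝ}
    (ht : (t : EReal) ≤ PO A B x) {U : List Rect} (hU : disjU U) (hm : multU U x < 0) :
    t * (-(multU U x) : ℝ) ≤ Lval A B U := by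
  have hm' : (0 : ℝ) < -(multU U x : ℝ) := by
    have : (multU U x : ℝ) < 0 := by exact_mod_cast hm
    linarith
  have h := ht.trans
    (iInf_le _ (⟨U, hU, hm⟩ : {U : List Rect // disjU U ∧ multU U x < 0}))
  exact (le_div_iff₀ hm').1 (EReal.coe_le_coe_iff.1 h)

lemma coe_le_PO {A B : EReal × EReal → ℝ} {x : EReal × EReal} {t : ℝ}
    (h : ∀ U, disjU U → multU U x < 0 → t * (-(multU U x) : ℝ) ≤ Lval A B U) :
    (t : EReal) ≤ PO A B x := by
  refine le_iInf fun ⟨U, hU, hm⟩ => EReal.coe_le_coe_iff.2 ?_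
  have hm' : (0 : ℝ) < -(multU U x : ℝ) := by
    have : (multU U x : ℝ) < 0 := by exact_mod_cast hm
    linarith
  exact (le_div_iff₀ hm').2 (h U hU hm)

/-- **Key modification lemma.** If `(A,B)` satisfies (Q1), (Q2) and `γ^{(A,B)}(x) > 0`,
then raising the value of `A` at `x` by any `t` with `0 < t ≤ γ^{(A,B)}(x)` preserves
(Q1) and (Q2); for `t = γ^{(A,B)}(x)` the new `γ` at `x` vanishes. -/
theorem key_modification_lemma
    (A B A' : EReal × EReal → ℝ) (hQ1 : CondQ1 A B) (hQ2 : CondQ2 A B)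
    (x : EReal × EReal) (hpos : 0 < gammaAB A B x)
    (t : ℝ) (ht : 0 < t) (htle : (t : EReal) ≤ gammaAB A B x)
    (hA' : ∀ y, A' y = if y = x then A x + t else A y) :
    (CondQ1 A' B ∧ CondQ2 A' B) ∧
      ((t : EReal) = gammaAB A B x → gammaAB A' B x = 0) := by
  have hL := Lval_add_single_left (B := B) hA'
  have hAx : A' x = A x + t := by rw [hA', if_pos rfl]
  have htPO : (t : EReal) ≤ PO A B x := htle.trans (min_le_left _ _)
  have htAB : t ≤ B x - A x := EReal.coe_le_coe_iff.1 (htle.trans (min_le_right _ _))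
  have hQ1' : CondQ1 A' B := by
    intro p
    by_cases hp : p = x
    · subst hp
      linarith
    · rw [hA', if_neg hp]
      exact hQ1 p
  have hQ2' : CondQ2 A' B := by
    intro U hU
    rw [hL]
    split_ifs with hm
    · linarith [mul_neg_multU_le_Lval htPO hU hm]
    · simpa using hQ2 U hU
  refine ⟨⟨hQ1', hQ2'⟩, fun hteq => le_antisymm ?_ ?_⟩
  · by_contra! hgt
    obtain ⟨c, hc0, hc⟩ := EReal.lt_iff_exists_real_btwn.1 hgt
    have hc0 : 0 < c := by exact_mod_cast hc0
    have hcPO : (c : EReal) ≤ PO A' B x := hc.le.trans (min_le_left _ _)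
    have hcAB : c ≤ B x - A' x := EReal.coe_le_coe_iff.1 (hc.le.trans (min_le_right _ _))
    have hle : ((t + c : ℝ) : EReal) ≤ gammaAB A B x := by
      refine le_min (coe_le_PO fun U hU hm => ?_) (EReal.coe_le_coe_iff.2 (by linarith))
      have h := mul_neg_multU_le_Lval hcPO hU hm
      rw [hL, if_pos hm] at h
      linarith
    rw [← hteq, EReal.coe_le_coe_iff] at hle
    linarith
  · refine le_min ?_ (EReal.coe_nonneg.2 (sub_nonneg.2 (hQ1' x)))
    rw [← EReal.coe_zero]
    exact coe_le_PO fun U hU _ => by simpa using hQ2' U hU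
end

section
/- Mesh approximation lemma: Let A be a bivariate quasi-distribution and F a bivariate distribution, both with margins F_X and F_Y. Let (Δ_n)_{n∈ℕ} be an increasing sequence of meshes (Δ_n ⊆ Δ_{n+1}) whose union of corner points 𝒰 satisfies: (1) 𝒰 is dense in R̄², (2) the set of first coordinates of points of 𝒰 contains every discontinuity point of F_X, and (3) the set of second coordinates of points of 𝒰 contains every discontinuity point of F_Y. If F ≤ A (respectively F ≥ A) holds at every point of Δ_n for all n ∈ ℕ, then F ≤ A (respectively F ≥ A) on all of R̄². -/
open scoped Classical

theorem IsDist.isQuasiDist {F : EReal × EReal → ℝ} (hF : IsDist F) : IsQuasiDist F :=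
  ⟨hF.1, hF.2.1, hF.2.2.1, hF.2.2.2.1, fun a₁ a₂ b₁ b₂ ha hb _ =>
    hF.2.2.2.2 a₁ a₂ b₁ b₂ ha hb⟩

/-- Horizontal increments of a quasi-distribution are dominated by those of its first margin. -/
theorem IsQuasiDist.abs_sub_le_fst {A : EReal × EReal → ℝ} {FX FY : EReal → ℝ}
    (hA : IsQuasiDist A) (hm : HasMargins A FX FY) (x x' y : EReal) :
    |A (x, y) - A (x', y)| ≤ |FX x - FX x'| := by
  obtain ⟨-, hbot, -, -, hvol⟩ := hA
  wlog h : x' ≤ x generalizing x x'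
  · rw [abs_sub_comm, abs_sub_comm (FX x)]
    exact this x' x (le_of_not_ge h)
  have lower := hvol x' x ⊥ y h bot_le (Or.inr (Or.inr (Or.inl (Or.inl rfl))))
  have upper := hvol x' x y ⊤ h le_top (Or.inr (Or.inr (Or.inr (Or.inr rfl))))
  simp only [vol, hbot, hm.1] at lower upper
  rw [abs_of_nonneg (by linarith), abs_of_nonneg (by linarith)]
  linarith

/-- Vertical increments of a quasi-distribution are dominated by those of its second margin. -/
theorem IsQuasiDist.abs_sub_le_snd {A : EReal × EReal → ℝ} {FX FY : EReal → ℝ}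
    (hA : IsQuasiDist A) (hm : HasMargins A FX FY) (x y y' : EReal) :
    |A (x, y) - A (x, y')| ≤ |FY y - FY y'| := by
  obtain ⟨-, -, hbot, -, hvol⟩ := hA
  wlog h : y' ≤ y generalizing y y'
  · rw [abs_sub_comm, abs_sub_comm (FY y)]
    exact this y' y (le_of_not_ge h)
  have lower := hvol ⊥ x y' y bot_le h (Or.inl (Or.inl rfl))
  have upper := hvol x ⊤ y' y le_top h (Or.inr (Or.inl (Or.inr rfl)))
  simp only [vol, hbot, hm.2] at lower upper
  rw [abs_of_nonneg (by linarith), abs_of_nonneg (by linarith)]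
  linarith

theorem IsQuasiDist.abs_sub_le_add {A : EReal × EReal → ℝ} {FX FY : EReal → ℝ}
    (hA : IsQuasiDist A) (hm : HasMargins A FX FY) (x x' y y' : EReal) :
    |A (x, y) - A (x', y')| ≤ |FX x - FX x'| + |FY y - FY y'| :=
  (abs_sub_le _ (A (x', y)) _).trans
    (add_le_add (hA.abs_sub_le_fst hm x x' y) (hA.abs_sub_le_snd hm x' y y'))

/-- A function can be approximated at every point by its values on a dense set containing
its discontinuities. -/
theorem Dense.exists_abs_sub_lt {X : Type*} [TopologicalSpace X] {s : Set X} (hs : Dense s)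
    {f : X → ℝ} (hf : ∀ x, ¬ ContinuousAt f x → x ∈ s) (x : X) {ε : ℝ} (hε : 0 < ε) :
    ∃ x' ∈ s, |f x - f x'| < ε := by
  by_cases hx : ContinuousAt f x
  · have hmem : f ⁻¹' Metric.ball (f x) ε ∈ nhds x := hx (Metric.ball_mem_nhds _ hε)
    obtain ⟨x', hxs, hx'⟩ := hs.inter_nhds_nonempty hmem
    exact ⟨x', hxs, by simpa [Real.dist_eq, abs_sub_comm] using hx'⟩
  · exact ⟨x, hf x hx, by simpa using hε⟩

/-- **Mesh approximation lemma.** If a quasi-distribution `A` and a distribution `F` with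
the same margins compare (`F ≤ A`, resp. `F ≥ A`) on every mesh of an increasing
sequence whose union of corners is dense and captures all discontinuities of the margins,
then they compare everywhere. -/
theorem mesh_approximation (FX FY : EReal → ℝ) (A F : EReal × EReal → ℝ)
    (hA : IsQuasiDist A) (hmA : HasMargins A FX FY)
    (hF : IsDist F) (hmF : HasMargins F FX FY)
    (Δ : ℕ → Mesh)
    (hmono : ∀ n, (Δ n).sx ⊆ (Δ (n + 1)).sx ∧ (Δ n).sy ⊆ (Δ (n + 1)).sy)
    (hdense : Dense (⋃ n, (((Δ n).sx : Set EReal) ×ˢ ((Δ n).sy : Set EReal))))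
    (hjumpX : ∀ x : EReal, ¬ ContinuousAt FX x → ∃ n, x ∈ (Δ n).sx)
    (hjumpY : ∀ y : EReal, ¬ ContinuousAt FY y → ∃ n, y ∈ (Δ n).sy) :
    ((∀ n, ∀ x ∈ (Δ n).sx, ∀ y ∈ (Δ n).sy, F (x, y) ≤ A (x, y)) →
      ∀ p : EReal × EReal, F p ≤ A p) ∧
    ((∀ n, ∀ x ∈ (Δ n).sx, ∀ y ∈ (Δ n).sy, A (x, y) ≤ F (x, y)) →
      ∀ p : EReal × EReal, A p ≤ F p) := by
  have hmonoX : Monotone fun n => (Δ n).sx := monotone_nat_of_le_succ fun n => (hmono n).1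
  have hmonoY : Monotone fun n => (Δ n).sy := monotone_nat_of_le_succ fun n => (hmono n).2
  have hdenseX : Dense (⋃ n, ((Δ n).sx : Set EReal)) := by
    refine (Prod.fst_surjective.denseRange.dense_image continuous_fst hdense).mono ?_
    rintro _ ⟨p, hp, rfl⟩
    obtain ⟨n, hn⟩ := Set.mem_iUnion.1 hp
    exact Set.mem_iUnion.2 ⟨n, hn.1⟩
  have hdenseY : Dense (⋃ n, ((Δ n).sy : Set EReal)) := by
    refine (Prod.snd_surjective.denseRange.dense_image continuous_snd hdense).mono ?_
    rintro _ ⟨p, hp, rfl⟩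
    obtain ⟨n, hn⟩ := Set.mem_iUnion.1 hp
    exact Set.mem_iUnion.2 ⟨n, hn.2⟩
  have approx : ∀ (x y : EReal) {ε : ℝ}, 0 < ε → ∃ n, ∃ x' ∈ (Δ n).sx, ∃ y' ∈ (Δ n).sy,
      |A (x, y) - A (x', y')| < ε / 2 ∧ |F (x, y) - F (x', y')| < ε / 2 := by
    intro x y ε hε
    obtain ⟨x', hx', hxε⟩ := hdenseX.exists_abs_sub_lt
      (fun x hx => Set.mem_iUnion.2 (hjumpX x hx)) x (show 0 < ε / 4 by linarith)
    obtain ⟨y', hy', hyε⟩ := hdenseY.exists_abs_sub_lt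
      (fun y hy => Set.mem_iUnion.2 (hjumpY y hy)) y (show 0 < ε / 4 by linarith)
    obtain ⟨m, hm⟩ := Set.mem_iUnion.1 hx'
    obtain ⟨k, hk⟩ := Set.mem_iUnion.1 hy'
    have hAle := hA.abs_sub_le_add hmA x x' y y'
    have hFle := hF.isQuasiDist.abs_sub_le_add hmF x x' y y'
    exact ⟨max m k, x', hmonoX (le_max_left m k) hm, y', hmonoY (le_max_right m k) hk,
      by linarith, by linarith⟩
  constructor
  all_goals
    rintro h ⟨x, y⟩
    refine le_of_forall_pos_le_add fun ε hε => ?_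
    obtain ⟨n, x', hx', y', hy', hAε, hFε⟩ := approx x y hε
    have hle := h n x' hx' y' hy'
    rw [abs_lt] at hAε hFε
    linarith [hAε.1, hAε.2, hFε.1, hFε.2]
end

section
/- Converse part of the imprecise Sklar theorem for fixed margins: Let (P,Q) be a coherent imprecise copula and let F_X, F_Y be arbitrary univariate distribution functions. Then A(x,y) = P(F_X(x),F_Y(y)) and B(x,y) = Q(F_X(x),F_Y(y)) are bivariate quasi-distributions with margins F_X, F_Y, and they satisfy: 𝔇(A,B) is nonempty, A = inf 𝔇(A,B) and B = sup 𝔇(A,B) pointwise. -/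
open scoped Classical

theorem UnivDist.mem_Icc {F : EReal → ℝ} (hF : UnivDist F) (x : EReal) :
    F x ∈ Set.Icc (0:ℝ) 1 :=
  ⟨hF.2.1 ▸ hF.1 bot_le, hF.2.2 ▸ hF.1 le_top⟩

/-- Composing a quasi-copula with univariate distribution functions gives a
quasi-distribution. -/
theorem IsQuasiCopula.isQuasiDist_comp {Q : ℝ → ℝ → ℝ} (hQ : IsQuasiCopula Q)
    {FX FY : EReal → ℝ} (hFX : UnivDist FX) (hFY : UnivDist FY) :
    IsQuasiDist fun p => Q (FX p.1) (FY p.2) := by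
  obtain ⟨hrange, hbd, hmono, hlip⟩ := hQ
  have h1 : (1:ℝ) ∈ Set.Icc (0:ℝ) 1 := by simp
  refine ⟨fun p => hrange _ (hFX.mem_Icc _) _ (hFY.mem_Icc _), fun x => ?_, fun y => ?_, ?_, ?_⟩
  · simpa only [hFY.2.1] using (hbd _ (hFX.mem_Icc x)).1
  · simpa only [hFX.2.1] using (hbd _ (hFY.mem_Icc y)).2.1
  · simpa only [hFX.2.2, hFY.2.2] using (hbd 1 h1).2.2.1
  · intro a₁ a₂ b₁ b₂ ha hb hinf
    have ma₁ := hFX.mem_Icc a₁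
    have ma₂ := hFX.mem_Icc a₂
    have mb₁ := hFY.mem_Icc b₁
    have mb₂ := hFY.mem_Icc b₂
    have ha' := hFX.1 ha
    have hb' := hFY.1 hb
    have hlipX : ∀ v ∈ Set.Icc (0:ℝ) 1, Q (FX a₂) v - Q (FX a₁) v ≤ FX a₂ - FX a₁ := by
      intro v hv
      have h := (abs_le.mp (hlip _ ma₂ _ ma₁ v hv v hv)).2
      rwa [sub_self, abs_zero, add_zero, abs_of_nonneg (sub_nonneg.mpr ha')] at h
    have hlipY : ∀ u ∈ Set.Icc (0:ℝ) 1, Q u (FY b₂) - Q u (FY b₁) ≤ FY b₂ - FY b₁ := by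
      intro u hu
      have h := (abs_le.mp (hlip u hu u hu _ mb₂ _ mb₁)).2
      rwa [sub_self, abs_zero, zero_add, abs_of_nonneg (sub_nonneg.mpr hb')] at h
    simp only [vol]
    rcases hinf with (rfl | rfl) | (rfl | rfl) | (rfl | rfl) | (rfl | rfl)
    · rw [hFX.2.1, (hbd _ mb₁).2.1, (hbd _ mb₂).2.1]
      linarith [(hmono _ mb₁ _ mb₂ _ ma₂ hb').2]
    · obtain rfl := top_le_iff.mp ha
      linarith
    · obtain rfl := le_bot_iff.mp ha
      linarith
    · rw [hFX.2.2, (hbd _ mb₁).2.2.2, (hbd _ mb₂).2.2.2]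
      linarith [hlipY _ ma₁]
    · rw [hFY.2.1, (hbd _ ma₁).1, (hbd _ ma₂).1]
      linarith [(hmono _ ma₁ _ ma₂ _ mb₂ ha').1]
    · obtain rfl := top_le_iff.mp hb
      linarith
    · obtain rfl := le_bot_iff.mp hb
      linarith
    · rw [hFY.2.2, (hbd _ ma₁).2.2.1, (hbd _ ma₂).2.2.1]
      linarith [hlipX _ mb₁]

theorem IsQuasiCopula.hasMargins_comp {Q : ℝ → ℝ → ℝ} (hQ : IsQuasiCopula Q)
    {FX FY : EReal → ℝ} (hFX : UnivDist FX) (hFY : UnivDist FY) :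
    HasMargins (fun p => Q (FX p.1) (FY p.2)) FX FY :=
  ⟨fun x => by simpa only [hFY.2.2] using (hQ.2.1 _ (hFX.mem_Icc x)).2.2.1,
    fun y => by simpa only [hFX.2.2] using (hQ.2.1 _ (hFY.mem_Icc y)).2.2.2⟩

/-- Composing a copula with univariate distribution functions gives a distribution. -/
theorem IsCopula.isDist_comp {C : ℝ → ℝ → ℝ} (hC : IsCopula C)
    {FX FY : EReal → ℝ} (hFX : UnivDist FX) (hFY : UnivDist FY) :
    IsDist fun p => C (FX p.1) (FY p.2) := by
  obtain ⟨hrange, hbd, hvol⟩ := hC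
  refine ⟨fun p => hrange _ (hFX.mem_Icc _) _ (hFY.mem_Icc _), fun x => ?_, fun y => ?_, ?_,
    fun a₁ a₂ b₁ b₂ ha hb => hvol _ (hFX.mem_Icc a₁) _ (hFX.mem_Icc a₂) _ (hFY.mem_Icc b₁) _
      (hFY.mem_Icc b₂) (hFX.1 ha) (hFY.1 hb)⟩
  · simpa only [hFY.2.1] using (hbd _ (hFX.mem_Icc x)).1
  · simpa only [hFX.2.1] using (hbd _ (hFY.mem_Icc y)).2.1
  · simpa only [hFX.2.2, hFY.2.2] using (hbd 1 (by simp)).2.2.1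

theorem IsCopula.hasMargins_comp {C : ℝ → ℝ → ℝ} (hC : IsCopula C)
    {FX FY : EReal → ℝ} (hFX : UnivDist FX) (hFY : UnivDist FY) :
    HasMargins (fun p => C (FX p.1) (FY p.2)) FX FY :=
  ⟨fun x => by simpa only [hFY.2.2] using (hC.2.1 _ (hFX.mem_Icc x)).2.2.1,
    fun y => by simpa only [hFX.2.2] using (hC.2.1 _ (hFY.mem_Icc y)).2.2.2⟩

theorem comp_mem_Dset {P Q C : ℝ → ℝ → ℝ} (hC : C ∈ Cset P Q)
    {FX FY : EReal → ℝ} (hFX : UnivDist FX) (hFY : UnivDist FY) :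
    (fun p : EReal × EReal => C (FX p.1) (FY p.2)) ∈
      Dset FX FY (fun p => P (FX p.1) (FY p.2)) (fun p => Q (FX p.1) (FY p.2)) :=
  ⟨hC.1.isDist_comp hFX hFY, hC.1.hasMargins_comp hFX hFY,
    fun _ => hC.2 _ (hFX.mem_Icc _) _ (hFY.mem_Icc _)⟩

/-- **Converse part of the imprecise Sklar theorem for fixed margins.** Composing a
coherent imprecise copula with arbitrary univariate distribution functions yields a
coherent restricted bivariate `p`-box. -/
theorem imprecise_sklar_converse
    (P Q : ℝ → ℝ → ℝ) (hcoh : CoherentImprecise P Q)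
    (FX FY : EReal → ℝ) (hFX : UnivDist FX) (hFY : UnivDist FY)
    (A B : EReal × EReal → ℝ)
    (hA : ∀ p : EReal × EReal, A p = P (FX p.1) (FY p.2))
    (hB : ∀ p : EReal × EReal, B p = Q (FX p.1) (FY p.2)) :
    IsQuasiDist A ∧ HasMargins A FX FY ∧
    IsQuasiDist B ∧ HasMargins B FX FY ∧
    (Dset FX FY A B).Nonempty ∧
    (∀ p, A p = pinf (Dset FX FY A B) p) ∧
    (∀ p, B p = psup (Dset FX FY A B) p) := by
  obtain rfl : A = fun p => P (FX p.1) (FY p.2) := funext hA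
  obtain rfl : B = fun p => Q (FX p.1) (FY p.2) := funext hB
  obtain ⟨hP, hQ, -, hne, hext⟩ := hcoh
  have hmem {C : ℝ → ℝ → ℝ} (hC : C ∈ Cset P Q) := comp_mem_Dset hC hFX hFY
  obtain ⟨C₀, hC₀⟩ := id hne
  have hD : (Dset FX FY (fun p => P (FX p.1) (FY p.2)) fun p => Q (FX p.1) (FY p.2)).Nonempty :=
    ⟨_, hmem hC₀⟩
  refine ⟨hP.isQuasiDist_comp hFX hFY, hP.hasMargins_comp hFX hFY, hQ.isQuasiDist_comp hFX hFY,
    hQ.hasMargins_comp hFX hFY, hD, fun p => le_antisymm ?_ ?_, fun p => le_antisymm ?_ ?_⟩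
  · exact le_csInf (hD.image _) (Set.forall_mem_image.mpr fun F hF => (hF.2.2 p).1)
  · refine le_of_le_of_eq ?_ (hext _ (hFX.mem_Icc p.1) _ (hFY.mem_Icc p.2)).1.symm
    refine le_csInf (hne.image _) (Set.forall_mem_image.mpr fun C hC => ?_)
    exact csInf_le ⟨_, Set.forall_mem_image.mpr fun F hF => (hF.2.2 p).1⟩ ⟨_, hmem hC, rfl⟩
  · refine le_of_eq_of_le (hext _ (hFX.mem_Icc p.1) _ (hFY.mem_Icc p.2)).2 ?_
    refine csSup_le (hne.image _) (Set.forall_mem_image.mpr fun C hC => ?_)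
    exact le_csSup ⟨_, Set.forall_mem_image.mpr fun F hF => (hF.2.2 p).2⟩ ⟨_, hmem hC, rfl⟩
  · exact csSup_le (hD.image _) (Set.forall_mem_image.mpr fun F hF => (hF.2.2 p).2)
end
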